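/- Every symmetric network in the asynchronous π-calculus π_a has at least one symmetric execution. -/

import Mathlib

set_option maxHeartbeats 1000000

/-! # Common definitions: the π-calculus with mixed choice (π_mix) and the
asynchronous π-calculus (π_a), their structural congruence and reduction
semantics, symmetric networks and symmetric executions, contexts, and
Gorla's quality criteria for encodings. -/

/-- Names. -/
abbrev Name : Type := ℕ

/-- The single-name substitution `{m/n}` mapping `n` to `m` and every other
name to itself. -/
def rename (n m : Name) : Name → Name := fun k => if k = n then m else k

/-! ## The asynchronous π-calculus π_a -/

/-- Processes of the asynchronous π-calculus π_a:
`P ::= (νn)P | P₁ | P₂ | !P | 0 | ȳ⟨z⟩ | y(x).P | [a=b]P | ✓`. -/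
inductive PiA : Type
  | nil : PiA
  | res : Name → PiA → PiA
  | par : PiA → PiA → PiA
  | repl : PiA → PiA
  | out : Name → Name → PiA
  | inp : Name → Name → PiA → PiA
  | mtch : Name → Name → PiA → PiA
  | succ : PiA
  deriving DecidableEq

namespace PiA

/-- Application of a substitution to a π_a process. -/
def subst (σ : Name → Name) : PiA → PiA
  | nil => nil
  | res n P => res (σ n) (subst σ P)
  | par P Q => par (subst σ P) (subst σ Q)
  | repl P => repl (subst σ P)
  | out y z => out (σ y) (σ z)
  | inp y x P => inp (σ y) (σ x) (subst σ P)
  | mtch a b P => mtch (σ a) (σ b) (subst σ P)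
  | succ => succ

/-- All names of a π_a process. -/
def names : PiA → Finset Name
  | nil => ∅
  | res n P => insert n (names P)
  | par P Q => names P ∪ names Q
  | repl P => names P
  | out y z => {y, z}
  | inp y x P => insert y (insert x (names P))
  | mtch a b P => insert a (insert b (names P))
  | succ => ∅

/-- Free names of a π_a process. -/
def fn : PiA → Finset Name
  | nil => ∅
  | res n P => (fn P).erase n
  | par P Q => fn P ∪ fn Q
  | repl P => fn P
  | out y z => {y, z}
  | inp y x P => insert y ((fn P).erase x)
  | mtch a b P => insert a (insert b (fn P))
  | succ => ∅

/-- Structural congruence of π_a: the least congruence containing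
α-conversion and the standard structural axioms. -/
inductive Cong : PiA → PiA → Prop
  | refl (P) : Cong P P
  | symm {P Q} : Cong P Q → Cong Q P
  | trans {P Q R} : Cong P Q → Cong Q R → Cong P R
  | resC (n) {P Q} : Cong P Q → Cong (res n P) (res n Q)
  | parC {P P' Q Q'} : Cong P P' → Cong Q Q' → Cong (par P Q) (par P' Q')
  | replC {P Q} : Cong P Q → Cong (repl P) (repl Q)
  | inpC (y x) {P Q} : Cong P Q → Cong (inp y x P) (inp y x Q)
  | mtchC (a b) {P Q} : Cong P Q → Cong (mtch a b P) (mtch a b Q)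
  | alphaRes {n m : Name} {P} : m ∉ names P →
      Cong (res n P) (res m (subst (rename n m) P))
  | alphaInp {y x x' : Name} {P} : x' ∉ names P →
      Cong (inp y x P) (inp y x' (subst (rename x x') P))
  | parNil (P) : Cong (par P nil) P
  | parComm (P Q) : Cong (par P Q) (par Q P)
  | parAssoc (P Q R) : Cong (par P (par Q R)) (par (par P Q) R)
  | mtchId (a : Name) (P) : Cong (mtch a a P) P
  | replUnfold (P) : Cong (repl P) (par P (repl P))
  | resNil (n : Name) : Cong (res n nil) nil
  | resSwap (n m : Name) (P) : Cong (res n (res m P)) (res m (res n P))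
  | resPar {n : Name} {P} (Q) : n ∉ fn P →
      Cong (par P (res n Q)) (res n (par P Q))

/-- The reduction relation ⟼ of π_a. -/
inductive Step : PiA → PiA → Prop
  | com (y x z : Name) (P) :
      Step (par (inp y x P) (out y z)) (subst (rename x z) P)
  | parS {P P'} (Q) : Step P P' → Step (par P Q) (par P' Q)
  | resS (n : Name) {P P'} : Step P P' → Step (res n P) (res n P')
  | congS {P P' Q Q'} : Cong P P' → Step P' Q' → Cong Q' Q → Step P Q

/-- The reflexive-transitive closure ⟹ of reduction in π_a. -/
abbrev Steps : PiA → PiA → Prop := Relation.ReflTransGen Step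

/-- `P` contains a top-level unguarded occurrence of ✓, i.e. `P ≡ P'' | ✓`. -/
def HasTopSuccess (P : PiA) : Prop := ∃ P'', Cong P (par P'' succ)

/-- `P` may lead to success: `P⇓`. -/
def May (P : PiA) : Prop := ∃ P', Steps P P' ∧ HasTopSuccess P'

/-- `P ⟼^ω`: `P` has an infinite sequence of reduction steps. -/
def Diverges (P : PiA) : Prop :=
  ∃ seq : ℕ → PiA, seq 0 = P ∧ ∀ i, Step (seq i) (seq (i + 1))

end PiA

/-! ## Networks and symmetric executions in π_a -/

/-- The parallel composition `P₁ | … | Pₙ` of a list of processes. -/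
def parList : List PiA → PiA
  | [] => PiA.nil
  | [P] => P
  | P :: Q :: rest => PiA.par P (parList (Q :: rest))

/-- The restriction `(νx̃)P` of a process by a sequence of names. -/
def resList : List Name → PiA → PiA
  | [], P => P
  | n :: ns, P => PiA.res n (resList ns P)

/-- `P` is a symmetric network of degree `n`: `P = (νx̃)(P₁ | … | Pₙ)` where
`Pᵢ = σ^(i-1)(P₁)` for a symmetry relation `σ` with `σⁿ = id`. -/
def SymNetwork (n : ℕ) (P : PiA) : Prop :=
  ∃ (xs : List Name) (Ps : List PiA) (σ : Name → Name),
    Ps.length = n ∧ σ^[n] = id ∧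
    (∀ i < n, Ps.getD i PiA.nil = PiA.subst (σ^[i]) (Ps.getD 0 PiA.nil)) ∧
    P = resList xs (parList Ps)

/-- `seq` (of length `len`, `none` meaning infinite) is a symmetric execution
of degree `n`: it starts at a symmetric network of degree `n`, returns to a
symmetric network of degree `n` after every `n`-th step, and is either
infinite or terminates in a symmetric network of degree `n`. -/
def IsSymExecution (n : ℕ) (seq : ℕ → PiA) (len : Option ℕ) : Prop :=
  SymNetwork n (seq 0) ∧
  match len with
  | none =>
      (∀ i, PiA.Step (seq i) (seq (i + 1))) ∧
      (∀ k, SymNetwork n (seq (n * k)))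
  | some m =>
      (∀ i < m, PiA.Step (seq i) (seq (i + 1))) ∧
      (∀ T, ¬ PiA.Step (seq m) T) ∧
      (∀ k, n * k ≤ m → SymNetwork n (seq (n * k))) ∧
      SymNetwork n (seq m)

/-! ## The π-calculus with mixed choice π_mix -/

/-- Prefixes (guards) `μ ::= y(x) | ȳ⟨z⟩`. -/
inductive Guard : Type
  | inp : Name → Name → Guard
  | out : Name → Name → Guard
  deriving DecidableEq

/-- Application of a substitution to a guard. -/
def Guard.subst (σ : Name → Name) : Guard → Guard
  | .inp y x => .inp (σ y) (σ x)
  | .out y z => .out (σ y) (σ z)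

/-- Processes of π_mix:
`P ::= (νn)P | P₁ | P₂ | !P | Σ_{i∈I} μᵢ.Pᵢ | ✓`; `0` is the empty sum. -/
inductive PiM : Type
  | res : Name → PiM → PiM
  | par : PiM → PiM → PiM
  | repl : PiM → PiM
  | sum : List (Guard × PiM) → PiM
  | succ : PiM

/-- The empty sum `0` of π_mix. -/
def zeroM : PiM := .sum []

mutual
  /-- Application of a substitution to a π_mix process. -/
  def substM (σ : Name → Name) : PiM → PiM
    | .res n P => .res (σ n) (substM σ P)
    | .par P Q => .par (substM σ P) (substM σ Q)
    | .repl P => .repl (substM σ P)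
    | .sum gs => .sum (substSummands σ gs)
    | .succ => .succ
  /-- Application of a substitution to a list of summands. -/
  def substSummands (σ : Name → Name) :
      List (Guard × PiM) → List (Guard × PiM)
    | [] => []
    | (g, P) :: rest => (g.subst σ, substM σ P) :: substSummands σ rest
end

mutual
  /-- All names of a π_mix process. -/
  def namesM : PiM → Finset Name
    | .res n P => insert n (namesM P)
    | .par P Q => namesM P ∪ namesM Q
    | .repl P => namesM P
    | .sum gs => namesSummands gs
    | .succ => ∅
  /-- All names of a list of summands. -/
  def namesSummands : List (Guard × PiM) → Finset Name
    | [] => ∅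
    | (.inp y x, P) :: rest =>
        insert y (insert x (namesM P)) ∪ namesSummands rest
    | (.out y z, P) :: rest =>
        insert y (insert z (namesM P)) ∪ namesSummands rest
end

mutual
  /-- Free names of a π_mix process. -/
  def fnM : PiM → Finset Name
    | .res n P => (fnM P).erase n
    | .par P Q => fnM P ∪ fnM Q
    | .repl P => fnM P
    | .sum gs => fnSummands gs
    | .succ => ∅
  /-- Free names of a list of summands. -/
  def fnSummands : List (Guard × PiM) → Finset Name
    | [] => ∅
    | (.inp y x, P) :: rest => insert y ((fnM P).erase x) ∪ fnSummands rest
    | (.out y z, P) :: rest => insert y (insert z (fnM P)) ∪ fnSummands rest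
end

/-- Structural congruence of π_mix. -/
inductive CongM : PiM → PiM → Prop
  | refl (P) : CongM P P
  | symm {P Q} : CongM P Q → CongM Q P
  | trans {P Q R} : CongM P Q → CongM Q R → CongM P R
  | resC (n : Name) {P Q} : CongM P Q → CongM (.res n P) (.res n Q)
  | parC {P P' Q Q'} : CongM P P' → CongM Q Q' → CongM (.par P Q) (.par P' Q')
  | replC {P Q} : CongM P Q → CongM (.repl P) (.repl Q)
  | alphaRes {n m : Name} {P} : m ∉ namesM P →
      CongM (.res n P) (.res m (substM (rename n m) P))
  | alphaInp {gs₁ gs₂ : List (Guard × PiM)} {y x x' : Name} {P} :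
      x' ∉ namesM P →
      CongM (.sum (gs₁ ++ (Guard.inp y x, P) :: gs₂))
            (.sum (gs₁ ++ (Guard.inp y x', substM (rename x x') P) :: gs₂))
  | sumPerm {gs gs' : List (Guard × PiM)} : gs.Perm gs' →
      CongM (.sum gs) (.sum gs')
  | parNil (P) : CongM (.par P zeroM) P
  | parComm (P Q) : CongM (.par P Q) (.par Q P)
  | parAssoc (P Q R) : CongM (.par P (.par Q R)) (.par (.par P Q) R)
  | replUnfold (P) : CongM (.repl P) (.par P (.repl P))
  | resNil (n : Name) : CongM (.res n zeroM) zeroM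
  | resSwap (n m : Name) (P) : CongM (.res n (.res m P)) (.res m (.res n P))
  | resPar {n : Name} {P} (Q) : n ∉ fnM P →
      CongM (.par P (.res n Q)) (.res n (.par P Q))

/-- The reduction relation ⟼ of π_mix:
`(…+ y(x).P +…) | (…+ ȳ⟨z⟩.Q +…) ⟼ P{z/x} | Q`, closed under parallel
composition, restriction and structural congruence. -/
inductive StepM : PiM → PiM → Prop
  | com {gs₁ gs₂ : List (Guard × PiM)} {y x z : Name} {P Q : PiM} :
      (Guard.inp y x, P) ∈ gs₁ → (Guard.out y z, Q) ∈ gs₂ →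
      StepM (.par (.sum gs₁) (.sum gs₂)) (.par (substM (rename x z) P) Q)
  | parS {P P'} (Q) : StepM P P' → StepM (.par P Q) (.par P' Q)
  | resS (n : Name) {P P'} : StepM P P' → StepM (.res n P) (.res n P')
  | congS {P P' Q Q'} : CongM P P' → StepM P' Q' → CongM Q' Q → StepM P Q

/-- The reflexive-transitive closure ⟹ of reduction in π_mix. -/
abbrev StepsM : PiM → PiM → Prop := Relation.ReflTransGen StepM

/-- `S` contains a top-level unguarded occurrence of ✓, i.e. `S ≡ S'' | ✓`. -/
def HasTopSuccessM (S : PiM) : Prop := ∃ S'', CongM S (.par S'' .succ)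

/-- `S` may lead to success: `S⇓`. -/
def MayM (S : PiM) : Prop := ∃ S', StepsM S S' ∧ HasTopSuccessM S'

/-- `S ⟼^ω`: `S` has an infinite sequence of reduction steps. -/
def DivergesM (S : PiM) : Prop :=
  ∃ seq : ℕ → PiM, seq 0 = S ∧ ∀ i, StepM (seq i) (seq (i + 1))

/-- `seq` (of length `len`, `none` meaning infinite) is a maximal execution:
it is either infinite or terminates in a process with no reduction step. -/
def IsMaxExecutionM (seq : ℕ → PiM) (len : Option ℕ) : Prop :=
  match len with
  | none => ∀ i, StepM (seq i) (seq (i + 1))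
  | some m => (∀ i < m, StepM (seq i) (seq (i + 1))) ∧ ∀ T, ¬ StepM (seq m) T

/-! ## α-equivalence on π_a -/

/-- α-conversion ≡α on π_a: the least congruence allowing renaming of
bound names (avoiding name clashes). -/
inductive AlphaA : PiA → PiA → Prop
  | refl (P) : AlphaA P P
  | symm {P Q} : AlphaA P Q → AlphaA Q P
  | trans {P Q R} : AlphaA P Q → AlphaA Q R → AlphaA P R
  | resC (n : Name) {P Q} : AlphaA P Q → AlphaA (.res n P) (.res n Q)
  | parC {P P' Q Q'} : AlphaA P P' → AlphaA Q Q' → AlphaA (.par P Q) (.par P' Q')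
  | replC {P Q} : AlphaA P Q → AlphaA (.repl P) (.repl Q)
  | inpC (y x : Name) {P Q} : AlphaA P Q → AlphaA (.inp y x P) (.inp y x Q)
  | mtchC (a b : Name) {P Q} : AlphaA P Q → AlphaA (.mtch a b P) (.mtch a b Q)
  | alphaRes {n m : Name} {P} : m ∉ PiA.names P →
      AlphaA (.res n P) (.res m (PiA.subst (rename n m) P))
  | alphaInp {y x x' : Name} {P} : x' ∉ PiA.names P →
      AlphaA (.inp y x P) (.inp y x' (PiA.subst (rename x x') P))

/-! ## Contexts of π_a -/

/-- `k`-ary contexts of π_a: π_a-terms with holes `·ᵢ`, `i : Fin k`. -/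
inductive CtxA : ℕ → Type
  | hole {k} : Fin k → CtxA k
  | nil {k} : CtxA k
  | res {k} : Name → CtxA k → CtxA k
  | par {k} : CtxA k → CtxA k → CtxA k
  | repl {k} : CtxA k → CtxA k
  | out {k} : Name → Name → CtxA k
  | inp {k} : Name → Name → CtxA k → CtxA k
  | mtch {k} : Name → Name → CtxA k → CtxA k
  | succ {k} : CtxA k

/-- Filling the holes of a context with processes. -/
def CtxA.fill {k : ℕ} : CtxA k → (Fin k → PiA) → PiA
  | .hole i, f => f i
  | .nil, _ => .nil
  | .res n C, f => .res n (C.fill f)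
  | .par C D, f => .par (C.fill f) (D.fill f)
  | .repl C, f => .repl (C.fill f)
  | .out y z, _ => .out y z
  | .inp y x C, f => .inp y x (C.fill f)
  | .mtch a b C, f => .mtch a b (C.fill f)
  | .succ, _ => .succ

/-- The number of occurrences of hole `·ᵢ` in a context. -/
def CtxA.holeCount {k : ℕ} : CtxA k → Fin k → ℕ
  | .hole i, j => if i = j then 1 else 0
  | .nil, _ => 0
  | .res _ C, j => C.holeCount j
  | .par C D, j => C.holeCount j + D.holeCount j
  | .repl C, j => C.holeCount j
  | .out _ _, _ => 0
  | .inp _ _ C, j => C.holeCount j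
  | .mtch _ _ C, j => C.holeCount j
  | .succ, _ => 0

/-! ## Operators of π_mix -/

/-- The operators of π_mix: restriction, parallel composition, replication,
a sum operator for every finite list of prefixes, and ✓. -/
inductive MixOp : Type
  | res : Name → MixOp
  | par : MixOp
  | repl : MixOp
  | sum : List Guard → MixOp
  | succ : MixOp

/-- The arity of a π_mix operator. -/
def MixOp.arity : MixOp → ℕ
  | .res _ => 1
  | .par => 2
  | .repl => 1
  | .sum gs => gs.length
  | .succ => 0

/-- Applying a π_mix operator to arguments. -/
def MixOp.apply : (op : MixOp) → (Fin op.arity → PiM) → PiM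
  | .res n, f => .res n (f ⟨0, by simp [MixOp.arity]⟩)
  | .par, f => .par (f ⟨0, by simp [MixOp.arity]⟩) (f ⟨1, by simp [MixOp.arity]⟩)
  | .repl, f => .repl (f ⟨0, by simp [MixOp.arity]⟩)
  | .sum gs, f => .sum (List.ofFn fun i : Fin gs.length => (gs.get i, f i))
  | .succ, _ => .succ

/-! ## Quality criteria for encodings (Gorla) -/

/-- Criterion 1 (Compositionality): for every operator `op` of π_mix and
every set of names `N` there is a context `C_op^N` such that
`⟦op(S₁,…,S_k)⟧ = C_op^N(⟦S₁⟧,…,⟦S_k⟧)` whenever `fn(S₁) ∪ … ∪ fn(S_k) = N`. -/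
def Compositional (enc : PiM → PiA) : Prop :=
  ∀ (op : MixOp) (N : Finset Name), ∃ C : CtxA op.arity,
    ∀ f : Fin op.arity → PiM,
      (Finset.univ.biUnion fun i => fnM (f i)) = N →
      enc (op.apply f) = C.fill (fun i => enc (f i))

/-- A renaming policy keeps distinct names distinct:
`n ≠ m` implies `φ(n) ∩ φ(m) = ∅`. -/
def PolicyOK (φ : Name → List Name) : Prop :=
  ∀ n m : Name, n ≠ m → ∀ x ∈ φ n, x ∉ φ m

/-- Criterion 2 (Name invariance) w.r.t. a renaming policy `φ`:
`⟦σ(S)⟧ ≡α σ'(⟦S⟧)` if `σ` is injective and `⟦σ(S)⟧ ≍ σ'(⟦S⟧)` otherwise,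
where `σ'` is such that `φ(σ(a)) = σ'(φ(a))` for every name `a`. -/
def NameInvariant (enc : PiM → PiA) (equiv : PiA → PiA → Prop)
    (φ : Name → List Name) : Prop :=
  ∀ (S : PiM) (σ : Name → Name), ∃ σ' : Name → Name,
    (∀ a : Name, φ (σ a) = (φ a).map σ') ∧
    (Function.Injective σ →
      AlphaA (enc (substM σ S)) (PiA.subst σ' (enc S))) ∧
    (¬ Function.Injective σ →
      equiv (enc (substM σ S)) (PiA.subst σ' (enc S)))

/-- Operational completeness: `S ⟹ S'` implies `⟦S⟧ ⟹ ≍ ⟦S'⟧`. -/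
def OperationallyComplete (enc : PiM → PiA) (equiv : PiA → PiA → Prop) : Prop :=
  ∀ S S', StepsM S S' → ∃ T, PiA.Steps (enc S) T ∧ equiv T (enc S')

/-- Operational soundness: `⟦S⟧ ⟹ T` implies `S ⟹ S'` and `T ⟹ ≍ ⟦S'⟧`
for some `S'`. -/
def OperationallySound (enc : PiM → PiA) (equiv : PiA → PiA → Prop) : Prop :=
  ∀ S T, PiA.Steps (enc S) T →
    ∃ S' T', StepsM S S' ∧ PiA.Steps T T' ∧ equiv T' (enc S')

/-- Criterion 4 (Divergence reflection): `⟦S⟧ ⟼^ω` implies `S ⟼^ω`. -/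
def DivergenceReflecting (enc : PiM → PiA) : Prop :=
  ∀ S, PiA.Diverges (enc S) → DivergesM S

/-- Criterion 5 (Success sensitiveness): `S⇓` iff `⟦S⟧⇓`. -/
def SuccessSensitive (enc : PiM → PiA) : Prop :=
  ∀ S, MayM S ↔ PiA.May (enc S)

/-- `≍` is success respecting: `P⇓` and `Q⇓̸` imply `P ≭ Q`. -/
def SuccessRespecting (equiv : PiA → PiA → Prop) : Prop :=
  ∀ T₁ T₂, PiA.May T₁ → ¬ PiA.May T₂ → ¬ equiv T₁ T₂

/-- A good encoding from π_mix into π_a w.r.t. a success-respecting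
behavioural equivalence `≍` on π_a and a renaming policy `φ`: it is
compositional, name invariant, operationally corresponding, divergence
reflecting and success sensitive. -/
structure GoodEncoding (enc : PiM → PiA) (equiv : PiA → PiA → Prop)
    (φ : Name → List Name) : Prop where
  equivEquivalence : Equivalence equiv
  successRespecting : SuccessRespecting equiv
  policyOK : PolicyOK φ
  compositional : Compositional enc
  nameInvariant : NameInvariant enc equiv φ
  complete : OperationallyComplete enc equiv
  sound : OperationallySound enc equiv
  divergenceReflecting : DivergenceReflecting enc
  successSensitive : SuccessSensitive enc

/-! ## The concrete counterexample terms (prefixes CCS-like, objects omitted) -/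

/-- The sum `ā + a`. -/
def aSum (a : Name) : PiM := .sum [(Guard.out a a, zeroM), (Guard.inp a a, zeroM)]

/-- The sum `b̄ + b.✓`. -/
def bSum (b : Name) : PiM := .sum [(Guard.out b b, zeroM), (Guard.inp b b, .succ)]

/-- `P ≔ (ā + a) | (b̄ + b.✓)`. -/
def Pterm (a b : Name) : PiM := .par (aSum a) (bSum b)

/-- `Q ≔ P | P`. -/
def Qterm (a b : Name) : PiM := .par (Pterm a b) (Pterm a b)

/-- The sum `ā + b + b.✓`. -/
def rSum1 (a b : Name) : PiM :=
  .sum [(Guard.out a a, zeroM), (Guard.inp b b, zeroM), (Guard.inp b b, .succ)]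

/-- The sum `b̄ + a + a.✓`. -/
def rSum2 (a b : Name) : PiM :=
  .sum [(Guard.out b b, zeroM), (Guard.inp a a, zeroM), (Guard.inp a a, .succ)]

/-- `R ≔ (ā + b + b.✓) | (b̄ + a + a.✓)`. -/
def Rterm (a b : Name) : PiM := .par (rSum1 a b) (rSum2 a b)

namespace PiA

/-! ## Substitutions -/

theorem subst_congr {f g : Name → Name} {P : PiA} (h : ∀ k ∈ names P, f k = g k) :
    subst f P = subst g P := by
  induction P <;> simp_all [subst, names]

theorem subst_subst (f g : Name → Name) (P : PiA) :
    subst f (subst g P) = subst (f ∘ g) P := by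
  induction P <;> simp_all [subst]

theorem subst_id (P : PiA) : subst id P = P := by
  induction P <;> simp_all [subst]

theorem names_subst (f : Name → Name) (P : PiA) : names (subst f P) = (names P).image f := by
  induction P <;> simp_all [subst, names, Finset.image_union, Finset.image_insert]

theorem fn_subset_names (P : PiA) : fn P ⊆ names P := by
  induction P with
  | nil => simp [fn, names]
  | res n P ih => exact (Finset.erase_subset _ _).trans (ih.trans (Finset.subset_insert _ _))
  | par P Q ihP ihQ => exact Finset.union_subset_union ihP ihQ
  | repl P ih => exact ih
  | out y z => simp [fn, names]
  | inp y x P ih =>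
    exact Finset.insert_subset_insert _
      ((Finset.erase_subset _ _).trans (ih.trans (Finset.subset_insert _ _)))
  | mtch a b P ih => exact Finset.insert_subset_insert _ (Finset.insert_subset_insert _ ih)
  | succ => simp [fn, names]

theorem mem_fn_subst {f : Name → Name} (hf : Function.Injective f) {n : Name} {P : PiA} :
    f n ∈ fn (subst f P) ↔ n ∈ fn P := by
  induction P <;> simp_all [subst, fn, hf.eq_iff]

theorem comp_rename {f : Name → Name} (hf : Function.Injective f) (n m : Name) :
    f ∘ rename n m = rename (f n) (f m) ∘ f := by
  funext k
  by_cases hk : k = n <;> simp [rename, hk, hf.eq_iff]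

theorem subst_rename {f : Name → Name} (hf : Function.Injective f) (n m : Name) (P : PiA) :
    subst f (subst (rename n m) P) = subst (rename (f n) (f m)) (subst f P) := by
  rw [subst_subst, subst_subst, comp_rename hf]

theorem rename_injOn {n m : Name} {s : Finset Name} (hm : m ∉ s) :
    Set.InjOn (rename n m) (insert n s : Finset Name) := by
  intro a ha b hb hab
  by_cases han : a = n <;> by_cases hbn : b = n <;> simp_all [rename]

theorem Cong.subst {f : Name → Name} (hf : Function.Injective f) {P Q : PiA}
    (h : Cong P Q) : Cong (subst f P) (subst f Q) := by
  induction h with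
  | refl P => exact .refl _
  | symm _ ih => exact ih.symm
  | trans _ _ ih₁ ih₂ => exact ih₁.trans ih₂
  | resC n _ ih => exact .resC _ ih
  | parC _ _ ih₁ ih₂ => exact .parC ih₁ ih₂
  | replC _ ih => exact .replC ih
  | inpC y x _ ih => exact .inpC _ _ ih
  | mtchC a b _ ih => exact .mtchC _ _ ih
  | alphaRes hm =>
    simp only [PiA.subst, subst_rename hf]
    exact .alphaRes (by simpa [names_subst, hf.eq_iff] using hm)
  | alphaInp hm =>
    simp only [PiA.subst, subst_rename hf]
    exact .alphaInp (by simpa [names_subst, hf.eq_iff] using hm)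
  | parNil P => exact .parNil _
  | parComm P Q => exact .parComm _ _
  | parAssoc P Q R => exact .parAssoc _ _ _
  | mtchId a P => exact .mtchId _ _
  | replUnfold P => exact .replUnfold _
  | resNil n => exact .resNil _
  | resSwap n m P => exact .resSwap _ _ _
  | resPar Q hn => exact .resPar _ (by rwa [mem_fn_subst hf])

theorem Step.subst {f : Name → Name} (hf : Function.Injective f) {P Q : PiA}
    (h : Step P Q) : Step (subst f P) (subst f Q) := by
  induction h with
  | com y x z P =>
    rw [subst_rename hf]
    exact .com _ _ _ _
  | parS Q _ ih => exact .parS _ ih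
  | resS n _ ih => exact .resS _ ih
  | congS h₁ _ h₂ ih => exact .congS (h₁.subst hf) ih (h₂.subst hf)

/-! ## Processes up to structural congruence -/

/-- Structural congruence as a setoid. -/
def congSetoid : Setoid PiA := ⟨Cong, .refl, .symm, .trans⟩

/-- Processes up to structural congruence; a commutative monoid under parallel composition. -/
def CongClass : Type := Quotient congSetoid

/-- The congruence class of a process. -/
def toClass (P : PiA) : CongClass := Quotient.mk congSetoid P

theorem toClass_eq {P Q : PiA} : toClass P = toClass Q ↔ Cong P Q :=
  ⟨fun h => Quotient.exact h, fun h => Quotient.sound h⟩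

instance : CommMonoid CongClass where
  mul := Quotient.map₂ par fun _ _ h _ _ h' => Cong.parC h h'
  one := toClass nil
  mul_assoc := by
    rintro ⟨P⟩ ⟨Q⟩ ⟨R⟩
    exact Quotient.sound (Cong.parAssoc P Q R).symm
  mul_comm := by
    rintro ⟨P⟩ ⟨Q⟩
    exact Quotient.sound (Cong.parComm P Q)
  one_mul := by
    rintro ⟨P⟩
    exact Quotient.sound ((Cong.parComm nil P).trans (Cong.parNil P))
  mul_one := by
    rintro ⟨P⟩
    exact Quotient.sound (Cong.parNil P)

theorem toClass_par (P Q : PiA) : toClass (par P Q) = toClass P * toClass Q := rfl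

theorem toClass_nil : toClass nil = 1 := rfl

theorem toClass_parList (l : List PiA) : toClass (parList l) = (l.map toClass).prod := by
  induction l with
  | nil => rfl
  | cons P l ih =>
    cases l with
    | nil => simp [parList]
    | cons Q l => rw [parList, toClass_par, ih, List.map_cons (a := P), List.prod_cons (a := toClass P)]

theorem Cong.resList (xs : List Name) {P Q : PiA} (h : Cong P Q) :
    Cong (resList xs P) (resList xs Q) := by
  induction xs with
  | nil => exact h
  | cons x xs ih => exact .resC x ih

theorem resList_append (xs ys : List Name) (P : PiA) :
    resList (xs ++ ys) P = resList xs (resList ys P) := by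
  induction xs with
  | nil => rfl
  | cons x xs ih => simp [_root_.resList, ih]

theorem fn_resList_subset (xs : List Name) (P : PiA) : fn (resList xs P) ⊆ fn P := by
  induction xs with
  | nil => rfl
  | cons x xs ih => exact (Finset.erase_subset _ _).trans ih

theorem mem_fn_parList {k : Name} {l : List PiA} :
    k ∈ fn (parList l) ↔ ∃ P ∈ l, k ∈ fn P := by
  induction l with
  | nil => simp [parList, fn]
  | cons P l ih =>
    cases l with
    | nil => simp [parList]
    | cons Q l => rw [parList, fn, Finset.mem_union, ih, List.exists_mem_cons_iff (a := P)]

theorem Cong.par_resList (ys : List Name) {P : PiA} (Q : PiA) (h : ∀ y ∈ ys, y ∉ fn P) :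
    Cong (par P (_root_.resList ys Q)) (_root_.resList ys (par P Q)) := by
  induction ys with
  | nil => exact .refl _
  | cons y ys ih =>
    exact (Cong.resPar _ (h y (by simp))).trans
      (.resC y (ih fun z hz => h z (List.mem_cons_of_mem _ hz)))

/-- Scope extrusion of one restriction for every component of a parallel composition. -/
theorem cong_extrude_parList (c : ℕ → Name) (B : ℕ → PiA) (k : ℕ)
    (h : ∀ i < k, ∀ j < k, i ≠ j → c i ∉ fn (B j)) :
    Cong (parList ((List.range k).map fun i => res (c i) (B i)))
      (resList ((List.range k).reverse.map c) (parList ((List.range k).map B))) := by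
  induction k with
  | zero => exact .refl _
  | succ k ih =>
    have ih' := ih fun i hi j hj => h i (by omega) j (by omega)
    have split (F : ℕ → PiA) : Cong (parList ((List.range (k + 1)).map F))
        (par (parList ((List.range k).map F)) (F k)) := by
      rw [← toClass_eq, toClass_par, toClass_parList, toClass_parList]
      simp [List.range_succ]
    refine (split _).trans ((Cong.parC ih' (.refl _)).trans ?_)
    have hrev : (List.range (k + 1)).reverse.map c = c k :: (List.range k).reverse.map c := by
      simp [List.range_succ]
    rw [hrev]
    refine (Cong.resPar _ fun hc => ?_).trans (.resC _ ?_)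
    · obtain ⟨P, hP, hc⟩ := mem_fn_parList.1 (fn_resList_subset _ _ hc)
      obtain ⟨i, hi, rfl⟩ := List.mem_map.1 hP
      have hi := List.mem_range.1 hi
      exact h k (by omega) i (by omega) (by omega) hc
    · refine (Cong.parComm _ _).trans ((Cong.par_resList _ _ fun y hy hc => ?_).trans
        (.resList _ ((Cong.parComm _ _).trans (split B).symm)))
      obtain ⟨i, hi, rfl⟩ := List.mem_map.1 hy
      have hi := List.mem_range.1 (List.mem_reverse.1 hi)
      exact h i (by omega) k (by omega) (by omega) hc

/-! ## Barbs and redexes -/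

/-- `P` has an unguarded output on the free name `y`. -/
def OutBarb : PiA → Name → Prop
  | nil, _ => False
  | res n P, y => y ≠ n ∧ OutBarb P y
  | par P Q, y => OutBarb P y ∨ OutBarb Q y
  | repl P, y => OutBarb P y
  | out a _, y => y = a
  | inp _ _ _, _ => False
  | mtch a b P, y => a = b ∧ OutBarb P y
  | succ, _ => False

/-- `P` has an unguarded input on the free name `y`. -/
def InBarb : PiA → Name → Prop
  | nil, _ => False
  | res n P, y => y ≠ n ∧ InBarb P y
  | par P Q, y => InBarb P y ∨ InBarb Q y
  | repl P, y => InBarb P y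
  | out _ _, _ => False
  | inp a _ _, y => y = a
  | mtch a b P, y => a = b ∧ InBarb P y
  | succ, _ => False

/-- `P` has an unguarded output and an unguarded input on the same name. -/
def HasRedex : PiA → Prop
  | nil => False
  | res _ P => HasRedex P
  | par P Q => HasRedex P ∨ HasRedex Q ∨
      ∃ y, (OutBarb P y ∧ InBarb Q y) ∨ (InBarb P y ∧ OutBarb Q y)
  | repl P => HasRedex P ∨ ∃ y, OutBarb P y ∧ InBarb P y
  | out _ _ => False
  | inp _ _ _ => False
  | mtch a b P => a = b ∧ HasRedex P
  | succ => False

theorem OutBarb.mem_fn {P : PiA} {y : Name} (h : OutBarb P y) : y ∈ fn P := by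
  induction P <;> simp_all [OutBarb, fn]
  tauto

theorem InBarb.mem_fn {P : PiA} {y : Name} (h : InBarb P y) : y ∈ fn P := by
  induction P <;> simp_all [InBarb, fn]
  tauto

theorem OutBarb.mem_names {P : PiA} {y : Name} (h : OutBarb P y) : y ∈ names P :=
  fn_subset_names P h.mem_fn

theorem InBarb.mem_names {P : PiA} {y : Name} (h : InBarb P y) : y ∈ names P :=
  fn_subset_names P h.mem_fn

theorem outBarb_subst {f : Name → Name} {P : PiA} (hf : Set.InjOn f (names P)) {y : Name} :
    OutBarb (subst f P) y ↔ ∃ x, f x = y ∧ OutBarb P x := by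
  induction P with
  | nil => simp [subst, OutBarb]
  | res n P ih =>
    simp only [names, Finset.coe_insert] at hf
    simp only [subst, OutBarb, ih (hf.mono (Set.subset_insert _ _))]
    constructor
    · rintro ⟨hn, x, rfl, hx⟩
      exact ⟨x, rfl, fun h => hn (h ▸ rfl), hx⟩
    · rintro ⟨x, rfl, hn, hx⟩
      exact ⟨fun h => hn (hf (.inr hx.mem_names) (.inl rfl) h), x, rfl, hx⟩
  | par P Q ihP ihQ =>
    simp only [names, Finset.coe_union] at hf
    simp only [subst, OutBarb, ihP (hf.mono Set.subset_union_left),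
      ihQ (hf.mono Set.subset_union_right)]
    grind
  | repl P ih => exact ih hf
  | out a z =>
    simp only [subst, OutBarb]
    grind
  | inp a x P ih => simp [subst, OutBarb]
  | mtch a b P ih =>
    simp only [names, Finset.coe_insert] at hf
    simp only [subst, OutBarb, ih (hf.mono fun _ h => .inr (.inr h)),
      hf.eq_iff (Set.mem_insert a _) (Set.mem_insert_of_mem _ (Set.mem_insert b _))]
    grind
  | succ => simp [subst, OutBarb]

theorem inBarb_subst {f : Name → Name} {P : PiA} (hf : Set.InjOn f (names P)) {y : Name} :
    InBarb (subst f P) y ↔ ∃ x, f x = y ∧ InBarb P x := by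
  induction P with
  | nil => simp [subst, InBarb]
  | res n P ih =>
    simp only [names, Finset.coe_insert] at hf
    simp only [subst, InBarb, ih (hf.mono (Set.subset_insert _ _))]
    constructor
    · rintro ⟨hn, x, rfl, hx⟩
      exact ⟨x, rfl, fun h => hn (h ▸ rfl), hx⟩
    · rintro ⟨x, rfl, hn, hx⟩
      exact ⟨fun h => hn (hf (.inr hx.mem_names) (.inl rfl) h), x, rfl, hx⟩
  | par P Q ihP ihQ =>
    simp only [names, Finset.coe_union] at hf
    simp only [subst, InBarb, ihP (hf.mono Set.subset_union_left),
      ihQ (hf.mono Set.subset_union_right)]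
    grind
  | repl P ih => exact ih hf
  | out a z => simp [subst, InBarb]
  | inp a x P ih =>
    simp only [subst, InBarb]
    grind
  | mtch a b P ih =>
    simp only [names, Finset.coe_insert] at hf
    simp only [subst, InBarb, ih (hf.mono fun _ h => .inr (.inr h)),
      hf.eq_iff (Set.mem_insert a _) (Set.mem_insert_of_mem _ (Set.mem_insert b _))]
    grind
  | succ => simp [subst, InBarb]

theorem hasRedex_subst {f : Name → Name} {P : PiA} (hf : Set.InjOn f (names P)) :
    HasRedex (subst f P) ↔ HasRedex P := by
  induction P with
  | nil => simp [subst, HasRedex]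
  | res n P ih =>
    simp only [names, Finset.coe_insert] at hf
    exact ih (hf.mono (Set.subset_insert _ _))
  | par P Q ihP ihQ =>
    simp only [names, Finset.coe_union] at hf
    have hP := hf.mono Set.subset_union_left
    have hQ := hf.mono Set.subset_union_right
    simp only [subst, HasRedex, ihP hP, ihQ hQ, outBarb_subst hP, outBarb_subst hQ,
      inBarb_subst hP, inBarb_subst hQ]
    refine or_congr_right (or_congr_right ⟨?_, ?_⟩)
    · rintro ⟨_, ⟨⟨x, rfl, hx⟩, x', he, hx'⟩ | ⟨⟨x, rfl, hx⟩, x', he, hx'⟩⟩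
      all_goals
        obtain rfl := hf (.inr hx'.mem_names) (.inl hx.mem_names) he
      exacts [⟨x', .inl ⟨hx, hx'⟩⟩, ⟨x', .inr ⟨hx, hx'⟩⟩]
    · rintro ⟨x, h | h⟩
      exacts [⟨f x, .inl ⟨⟨x, rfl, h.1⟩, x, rfl, h.2⟩⟩, ⟨f x, .inr ⟨⟨x, rfl, h.1⟩, x, rfl, h.2⟩⟩]
  | repl P ih =>
    simp only [names] at hf
    simp only [subst, HasRedex, ih hf, outBarb_subst hf, inBarb_subst hf]
    refine or_congr_right ⟨?_, ?_⟩
    · rintro ⟨_, ⟨x, rfl, hx⟩, x', he, hx'⟩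
      obtain rfl := hf hx'.mem_names hx.mem_names he
      exact ⟨x', hx, hx'⟩
    · rintro ⟨x, h⟩
      exact ⟨f x, ⟨x, rfl, h.1⟩, x, rfl, h.2⟩
  | out a z => simp [subst, HasRedex]
  | inp a x P ih => simp [subst, HasRedex]
  | mtch a b P ih =>
    simp only [names, Finset.coe_insert] at hf
    simp only [subst, HasRedex, ih (hf.mono fun _ h => .inr (.inr h)),
      hf.eq_iff (Set.mem_insert a _) (Set.mem_insert_of_mem _ (Set.mem_insert b _))]
  | succ => simp [subst, HasRedex]

theorem Cong.outBarb_iff {P Q : PiA} (h : Cong P Q) (y : Name) :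
    OutBarb P y ↔ OutBarb Q y := by
  induction h with
  | symm _ ih => exact ih.symm
  | trans _ _ ih₁ ih₂ => exact ih₁.trans ih₂
  | @alphaRes n m P hm =>
    have hf := rename_injOn (n := n) hm
    have := outBarb_subst (P := res n P) hf (y := y)
    simp only [PiA.subst, show rename n m n = m by simp [rename]] at this
    rw [this]
    constructor
    · rintro ⟨hn, hy⟩
      exact ⟨y, by simp [rename, hn], hn, hy⟩
    · rintro ⟨x, rfl, hn, hx⟩
      simpa [rename, hn, OutBarb] using hx
  | resPar Q hn =>
    simp only [OutBarb]
    have := fun h : OutBarb _ _ => hn h.mem_fn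
    grind
  | _ => simp only [OutBarb] at * <;> grind

theorem Cong.inBarb_iff {P Q : PiA} (h : Cong P Q) (y : Name) :
    InBarb P y ↔ InBarb Q y := by
  induction h with
  | symm _ ih => exact ih.symm
  | trans _ _ ih₁ ih₂ => exact ih₁.trans ih₂
  | @alphaRes n m P hm =>
    have hf := rename_injOn (n := n) hm
    have := inBarb_subst (P := res n P) hf (y := y)
    simp only [PiA.subst, show rename n m n = m by simp [rename]] at this
    rw [this]
    constructor
    · rintro ⟨hn, hy⟩
      exact ⟨y, by simp [rename, hn], hn, hy⟩
    · rintro ⟨x, rfl, hn, hx⟩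
      simpa [rename, hn, InBarb] using hx
  | resPar Q hn =>
    simp only [InBarb]
    have := fun h : InBarb _ _ => hn h.mem_fn
    grind
  | _ => simp only [InBarb] at * <;> grind

theorem Cong.hasRedex_iff {P Q : PiA} (h : Cong P Q) : HasRedex P ↔ HasRedex Q := by
  induction h with
  | symm _ ih => exact ih.symm
  | trans _ _ ih₁ ih₂ => exact ih₁.trans ih₂
  | parC h₁ h₂ ih₁ ih₂ =>
    simp only [HasRedex, ih₁, ih₂, h₁.outBarb_iff, h₂.outBarb_iff, h₁.inBarb_iff, h₂.inBarb_iff]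
  | replC h ih => simp only [HasRedex, ih, h.outBarb_iff, h.inBarb_iff]
  | @alphaRes n m P hm =>
    exact (hasRedex_subst ((rename_injOn (n := n) hm).mono (by simp [names]))).symm
  | @resPar n P Q hn =>
    simp only [HasRedex, OutBarb, InBarb]
    have h₁ : ∀ y, OutBarb P y → y ≠ n := fun y h e => hn (e ▸ h.mem_fn)
    have h₂ : ∀ y, InBarb P y → y ≠ n := fun y h e => hn (e ▸ h.mem_fn)
    grind
  | _ => simp only [HasRedex, OutBarb, InBarb] at * <;> grind

theorem Step.hasRedex {P Q : PiA} (h : Step P Q) : HasRedex P := by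
  induction h with
  | com y x z P => exact .inr (.inr ⟨y, .inr ⟨rfl, rfl⟩⟩)
  | parS Q _ ih => exact .inl ih
  | resS n _ ih => exact ih
  | congS h _ _ ih => exact h.hasRedex_iff.2 ih

/-! ## From barbs to reductions -/

theorem Cong.alpha_out {c m y z : Name} {A : PiA} (hc : c ≠ y)
    (hm : m ∉ names (par (out y z) A)) :
    Cong (res c (par (out y z) A))
      (res m (par (out y (rename c m z)) (PiA.subst (rename c m) A))) := by
  have h := Cong.alphaRes (n := c) hm
  simpa only [PiA.subst, show rename c m y = y by simp [rename, hc.symm]] using h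

/-- An unguarded output can be brought to the top level, below at most one restriction. -/
theorem OutBarb.exists_cong {P : PiA} {y : Name} (h : OutBarb P y) (N : Finset Name) :
    ∃ c z A, c ∉ N ∧ c ≠ y ∧ Cong P (res c (par (out y z) A)) := by
  have hpar (P Q : PiA) (N : Finset Name) (ih : ∀ N : Finset Name,
      ∃ c z A, c ∉ N ∧ c ≠ y ∧ Cong P (res c (par (out y z) A))) :
      ∃ c z A, c ∉ N ∧ c ≠ y ∧ Cong (par P Q) (res c (par (out y z) A)) := by
    obtain ⟨c, z, A, hcN, hcy, hP⟩ := ih (N ∪ fn Q)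
    simp only [Finset.mem_union, not_or] at hcN
    refine ⟨c, z, par Q A, hcN.1, hcy, (Cong.parC hP (.refl Q)).trans
      ((Cong.parComm _ _).trans ((Cong.resPar _ hcN.2).trans (.resC c ?_)))⟩
    simp only [← toClass_eq, toClass_par]
    ac_rfl
  induction P generalizing N with
  | nil => exact h.elim
  | res n P ih =>
    obtain ⟨hyn, h⟩ := h
    obtain ⟨c, z, A, hcN, hcy, hP⟩ := ih h (insert n N)
    simp only [Finset.mem_insert, not_or] at hcN
    by_cases hz : z = n
    · subst hz
      have h₁ : Cong (res z P) (res z (par (out y z) (res c A))) :=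
        (Cong.resC z hP).trans (.resC z (Cong.resPar _ (by simp [fn, hcy, hcN.1])).symm)
      obtain ⟨m, hm⟩ := Infinite.exists_notMem_finset
        (insert y (N ∪ names (par (out y z) (res c A))))
      simp only [Finset.mem_insert, Finset.mem_union, not_or] at hm
      exact ⟨m, _, _, hm.2.1, hm.1, h₁.trans (.alpha_out hyn.symm hm.2.2)⟩
    · exact ⟨c, z, res n A, hcN.2, hcy, (Cong.resC n hP).trans ((Cong.resSwap _ _ _).trans
        (.resC c (Cong.resPar _ (by simp [fn, hyn.symm, Ne.symm hz])).symm))⟩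
  | par P Q ihP ihQ =>
    rcases h with h | h
    · exact hpar P Q N (ihP h)
    · obtain ⟨c, z, A, hcN, hcy, hA⟩ := hpar Q P N (ihQ h)
      exact ⟨c, z, A, hcN, hcy, (Cong.parComm _ _).trans hA⟩
  | repl P ih =>
    obtain ⟨c, z, A, hcN, hcy, hA⟩ := hpar P (repl P) N (ih h)
    exact ⟨c, z, A, hcN, hcy, (Cong.replUnfold _).trans hA⟩
  | out a z =>
    obtain rfl : y = a := h
    obtain ⟨c, hc⟩ := Infinite.exists_notMem_finset (insert y (insert z N))
    simp only [Finset.mem_insert, not_or] at hc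
    exact ⟨c, z, nil, hc.2.2, hc.1, (Cong.parNil _).symm.trans
      ((Cong.parC (.refl _) (Cong.resNil c).symm).trans
        (.resPar _ (by simp [fn, hc.1, hc.2.1])))⟩
  | inp a x P ih => exact h.elim
  | mtch a b P ih =>
    obtain ⟨rfl, h⟩ := h
    obtain ⟨c, z, A, hcN, hcy, hA⟩ := ih h N
    exact ⟨c, z, A, hcN, hcy, (Cong.mtchId _ _).trans hA⟩
  | succ => exact h.elim

theorem InBarb.exists_step {P : PiA} {y : Name} (h : InBarb P y) (z : Name) :
    ∃ P', Step (par P (out y z)) P' := by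
  have hpar (z : Name) (P Q : PiA) (ih : ∃ P', Step (par P (out y z)) P') :
      ∃ P', Step (par (par P Q) (out y z)) P' := by
    obtain ⟨P', hP⟩ := ih
    refine ⟨par P' Q, .congS ?_ (.parS Q hP) (.refl _)⟩
    simp only [← toClass_eq, toClass_par]
    ac_rfl
  have hcong {z : Name} {P Q : PiA} (hPQ : Cong P Q) (ih : ∃ P', Step (par Q (out y z)) P') :
      ∃ P', Step (par P (out y z)) P' :=
    ih.imp fun _ hP => .congS (.parC hPQ (.refl _)) hP (.refl _)
  induction P generalizing z with
  | nil => exact h.elim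
  | res n P ih =>
    obtain ⟨hyn, h⟩ := h
    have key (m : Name) (Q Q' : PiA) (hmy : m ≠ y) (hmz : m ≠ z)
        (hQ : Step (par Q (out y z)) Q') : ∃ P', Step (par (res m Q) (out y z)) P' :=
      ⟨res m Q', .congS ((Cong.parComm _ _).trans ((Cong.resPar _ (by simp [fn, hmy, hmz])).trans
        (.resC m (.parComm _ _)))) (.resS m hQ) (.refl _)⟩
    by_cases hz : z = n
    · obtain ⟨m, hm⟩ := Infinite.exists_notMem_finset (insert y (insert n (names P)))
      simp only [Finset.mem_insert, not_or] at hm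
      obtain ⟨P', hP⟩ := ih h m
      have hs := hP.subst (Equiv.swap n m).injective
      have hPs : PiA.subst (Equiv.swap n m) P = PiA.subst (rename n m) P :=
        subst_congr fun k hk => by
          have hkm : k ≠ m := fun e => hm.2.2 (e ▸ hk)
          by_cases hkn : k = n
          · simp [rename, hkn]
          · simp [rename, hkn, Equiv.swap_apply_of_ne_of_ne hkn hkm]
      simp only [PiA.subst, hPs, Equiv.swap_apply_of_ne_of_ne hyn (Ne.symm hm.1),
        Equiv.swap_apply_right] at hs
      subst hz
      exact hcong (.alphaRes hm.2.2) (key m _ _ hm.1 hm.2.1 hs)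
    · obtain ⟨P', hP⟩ := ih h z
      exact key n P P' hyn.symm (Ne.symm hz) hP
  | par P Q ihP ihQ =>
    rcases h with h | h
    · exact hpar z P Q (ihP h z)
    · exact hcong (.parComm _ _) (hpar z Q P (ihQ h z))
  | repl P ih => exact hcong (.replUnfold _) (hpar z P _ (ih h z))
  | out a z => exact h.elim
  | inp a x P ih =>
    obtain rfl : y = a := h
    exact ⟨_, .com _ _ _ _⟩
  | mtch a b P ih =>
    obtain ⟨rfl, h⟩ := h
    exact hcong (.mtchId _ _) (ih h z)
  | succ => exact h.elim

theorem exists_step_par_of_barbs {P Q : PiA} {y : Name} (hP : OutBarb P y) (hQ : InBarb Q y) :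
    ∃ T, Step (par P Q) T := by
  obtain ⟨c, z, A, hcN, -, hA⟩ := hP.exists_cong (fn Q)
  obtain ⟨Q', hQ'⟩ := hQ.exists_step z
  refine ⟨res c (par Q' A), .congS ?_ (.resS c (.parS A hQ')) (.refl _)⟩
  refine (Cong.parC hA (.refl Q)).trans ((Cong.parComm _ _).trans
    ((Cong.resPar _ hcN).trans (.resC c ?_)))
  simp only [← toClass_eq, toClass_par]
  ac_rfl

theorem exists_step_of_cong {P Q : PiA} (h : Cong P Q) (hQ : ∃ T, Step Q T) : ∃ T, Step P T :=
  hQ.imp fun T hT => .congS h hT (.refl T)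

theorem HasRedex.exists_step {P : PiA} (h : HasRedex P) : ∃ T, Step P T := by
  induction P with
  | nil => exact h.elim
  | res n P ih =>
    obtain ⟨T, hT⟩ := ih h
    exact ⟨_, .resS n hT⟩
  | par P Q ihP ihQ =>
    rcases h with h | h | ⟨y, h | h⟩
    · obtain ⟨T, hT⟩ := ihP h
      exact ⟨_, .parS Q hT⟩
    · obtain ⟨T, hT⟩ := ihQ h
      exact ⟨_, .congS (.parComm _ _) (.parS P hT) (.refl _)⟩
    · exact exists_step_par_of_barbs h.1 h.2
    · exact exists_step_of_cong (.parComm _ _) (exists_step_par_of_barbs h.2 h.1)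
  | repl P ih =>
    refine exists_step_of_cong (.replUnfold P) ?_
    rcases h with h | ⟨y, h⟩
    · obtain ⟨T, hT⟩ := ih h
      exact ⟨_, .parS _ hT⟩
    · exact exists_step_par_of_barbs (Q := repl P) h.1 h.2
  | out a z => exact h.elim
  | inp a x P ih => exact h.elim
  | mtch a b P ih =>
    obtain ⟨rfl, h⟩ := h
    exact exists_step_of_cong (.mtchId _ _) (ih h)
  | succ => exact h.elim

theorem hasRedex_resList {xs : List Name} {P : PiA} : HasRedex (resList xs P) ↔ HasRedex P := by
  induction xs with
  | nil => rfl
  | cons x xs ih => exact ih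

theorem outBarb_parList {l : List PiA} {y : Name} :
    OutBarb (parList l) y ↔ ∃ P ∈ l, OutBarb P y := by
  induction l with
  | nil => simp [parList, OutBarb]
  | cons P l ih =>
    cases l with
    | nil => simp [parList]
    | cons Q l => rw [parList, OutBarb, ih, List.exists_mem_cons_iff (a := P)]

theorem inBarb_parList {l : List PiA} {y : Name} :
    InBarb (parList l) y ↔ ∃ P ∈ l, InBarb P y := by
  induction l with
  | nil => simp [parList, InBarb]
  | cons P l ih =>
    cases l with
    | nil => simp [parList]
    | cons Q l => rw [parList, InBarb, ih, List.exists_mem_cons_iff (a := P)]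

theorem hasRedex_parList {l : List PiA} (h : HasRedex (parList l)) :
    (∃ P ∈ l, HasRedex P) ∨ ∃ P ∈ l, ∃ Q ∈ l, ∃ y, OutBarb P y ∧ InBarb Q y := by
  induction l with
  | nil => exact h.elim
  | cons P l ih =>
    cases l with
    | nil => exact .inl ⟨P, by simp, h⟩
    | cons Q l =>
      rw [parList, HasRedex] at h
      simp only [outBarb_parList, inBarb_parList] at h
      generalize Q :: l = l at h ih
      rcases h with h | h | ⟨y, ⟨h, R, hR, h'⟩ | ⟨h, R, hR, h'⟩⟩
      · exact .inl ⟨P, by simp, h⟩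
      · rcases ih h with ⟨R, hR, h⟩ | ⟨R, hR, S, hS, h⟩
        · exact .inl ⟨R, by simp [hR], h⟩
        · exact .inr ⟨R, by simp [hR], S, by simp [hS], h⟩
      · exact .inr ⟨P, by simp, R, by simp [hR], y, h, h'⟩
      · exact .inr ⟨R, by simp [hR], P, by simp, y, h', h⟩

/-! ## Counted reductions -/

/-- Reduction in exactly `k` steps. -/
def StepN : ℕ → PiA → PiA → Prop
  | 0, P, Q => P = Q
  | k + 1, P, Q => ∃ R, Step P R ∧ StepN k R Q

theorem StepN.map {f : PiA → PiA} (hf : ∀ {P Q}, Step P Q → Step (f P) (f Q)) {k : ℕ}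
    {P Q : PiA} (h : StepN k P Q) : StepN k (f P) (f Q) := by
  induction k generalizing P with
  | zero => exact congrArg f h
  | succ k ih =>
    obtain ⟨R, hR, h⟩ := h
    exact ⟨f R, hf hR, ih h⟩

theorem Step.resList (xs : List Name) {P Q : PiA} (h : Step P Q) :
    Step (resList xs P) (resList xs Q) := by
  induction xs with
  | nil => exact h
  | cons x xs ih => exact .resS x ih

theorem StepN.of_cong {k : ℕ} (hk : k ≠ 0) {P P' Q : PiA} (hP : Cong P P')
    (h : StepN k P' Q) : StepN k P Q := by
  cases k with
  | zero => exact absurd rfl hk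
  | succ k =>
    obtain ⟨R, hR, h⟩ := h
    exact ⟨R, .congS hP hR (.refl R), h⟩

theorem stepN_parList {l l' : List PiA} (h : List.Forall₂ Step l l') :
    StepN l.length (parList l) (parList l') := by
  induction h with
  | nil => rfl
  | @cons P P' l l' hP hl ih =>
    cases hl with
    | nil => exact ⟨P', hP, rfl⟩
    | @cons Q Q' l l' hQ hl =>
      refine ⟨_, .parS _ hP, ih.map (f := par P') fun h => ?_⟩
      exact .congS (.parComm _ _) (.parS _ h) (.parComm _ _)

theorem StepN.exists_seq {k : ℕ} {P Q : PiA} (h : StepN k P Q) :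
    ∃ g : ℕ → PiA, g 0 = P ∧ g k = Q ∧ ∀ i < k, Step (g i) (g (i + 1)) := by
  induction k generalizing P with
  | zero => exact ⟨fun _ => P, rfl, h, by simp⟩
  | succ k ih =>
    obtain ⟨R, hR, h⟩ := h
    obtain ⟨g, h0, hk, hg⟩ := ih h
    refine ⟨fun i => Nat.casesOn i P g, rfl, hk, fun i hi => ?_⟩
    cases i with
    | zero => simpa [h0] using hR
    | succ i => exact hg i (by omega)

end PiA

open PiA

/-! ## Symmetric networks -/

/-- The components of a symmetric network of degree `n` generated by `X`. -/
def orbitList (n : ℕ) (σ : Name → Name) (X : PiA) : List PiA :=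
  (List.range n).map fun i => subst (σ^[i]) X

theorem symNetwork_iff {n : ℕ} {P : PiA} : SymNetwork n P ↔
    ∃ (xs : List Name) (X : PiA) (σ : Name → Name),
      σ^[n] = id ∧ P = resList xs (parList (orbitList n σ X)) := by
  constructor
  · rintro ⟨xs, Ps, σ, rfl, hσ, h, rfl⟩
    refine ⟨xs, Ps.getD 0 nil, σ, hσ, ?_⟩
    congr 2
    refine List.ext_getElem (by simp [orbitList]) fun i h₁ _ => ?_
    have := h i h₁
    rw [List.getD_eq_getElem _ _ h₁] at this
    simpa [orbitList] using this
  · rintro ⟨xs, X, σ, hσ, rfl⟩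
    refine ⟨xs, orbitList n σ X, σ, by simp [orbitList], hσ, fun i hi => ?_, rfl⟩
    have h0 : 0 < n := by omega
    simp [orbitList, hi, h0, subst_id]

theorem injective_of_iterate_eq_id {n : ℕ} (hn : n ≠ 0) {σ : Name → Name} (hσ : σ^[n] = id) :
    Function.Injective σ := by
  obtain ⟨k, rfl⟩ := Nat.exists_eq_succ_of_ne_zero hn
  rw [Function.iterate_succ] at hσ
  exact Function.Injective.of_comp (f := σ^[k]) (hσ ▸ Function.injective_id)

theorem iterate_mul_eq_id {n : ℕ} {σ : Name → Name} (hσ : σ^[n] = id) (k : ℕ) :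
    σ^[n * k] = id := by
  rw [Function.iterate_mul, hσ, Function.iterate_id]

/-- If the generator of a symmetric network steps, then the network performs one step in every
component and becomes symmetric again. -/
theorem exists_stepN_of_step {n : ℕ} (hn : n ≠ 0) {σ : Name → Name} (hσ : σ^[n] = id)
    {xs : List Name} {P X X' : PiA} (hP : Cong P (resList xs (parList (orbitList n σ X))))
    (h : Step X X') : ∃ P', SymNetwork n P' ∧ StepN n P P' := by
  refine ⟨resList xs (parList (orbitList n σ X')), symNetwork_iff.2 ⟨xs, X', σ, hσ, rfl⟩,
    StepN.of_cong hn hP (StepN.map (Step.resList xs) ?_)⟩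
  have hl : List.Forall₂ Step (orbitList n σ X) (orbitList n σ X') := by
    rw [orbitList, orbitList, List.forall₂_map_left_iff, List.forall₂_map_right_iff,
      List.forall₂_same]
    exact fun i _ => h.subst ((injective_of_iterate_eq_id hn hσ).iterate i)
  simpa [orbitList] using stepN_parList hl

/-- A periodic symmetry relation can be changed outside a finite invariant set so that it
permutes a block of fresh names cyclically. -/
theorem exists_fresh_cycle {n : ℕ} (hn : n ≠ 0) {σ : ℕ → ℕ} (hσ : σ^[n] = id)
    {N : Finset ℕ} (hN : ∀ k ∈ N, σ k ∈ N) {M : ℕ} (hM : ∀ k ∈ N, k < M) :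
    ∃ τ : ℕ → ℕ, τ^[n] = id ∧ (∀ k ∈ N, ∀ i, τ^[i] k = σ^[i] k) ∧
      (∀ k < M, ∀ i, τ^[i] k < M) ∧ ∀ i < n, τ^[i] M = M + i := by
  let τ : ℕ → ℕ := fun k =>
    if k ∈ N then σ k else if M ≤ k ∧ k < M + n then (if k + 1 = M + n then M else k + 1) else k
  have hτN : ∀ i, ∀ k ∈ N, τ^[i] k = σ^[i] k := by
    intro i
    induction i with
    | zero => exact fun _ _ => rfl
    | succ i ih =>
      intro k hk
      rw [Function.iterate_succ_apply, Function.iterate_succ_apply,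
        show τ k = σ k from if_pos hk, ih _ (hN k hk)]
  have hσN : ∀ i, ∀ k ∈ N, σ^[i] k ∈ N := by
    intro i
    induction i with
    | zero => exact fun _ hk => hk
    | succ i ih => exact fun k hk => ih _ (hN k hk)
  have hfix : ∀ k, k ∉ N → ¬ (M ≤ k ∧ k < M + n) → ∀ i, τ^[i] k = k := fun k h₁ h₂ i =>
    Function.iterate_fixed (by simp only [τ, if_neg h₁, if_neg h₂]) i
  have hblock : ∀ k, M ≤ k → k ∉ N := fun k h hk => absurd (hM k hk) (by omega)
  have hcyc : ∀ i < n, τ^[i] M = M + i := by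
    intro i
    induction i with
    | zero => exact fun _ => rfl
    | succ i ih =>
      intro hi
      rw [Function.iterate_succ_apply', ih (by omega)]
      simp only [τ, if_neg (hblock (M + i) (by omega))]
      split_ifs <;> omega
  have hcycn : τ^[n] M = M := by
    obtain ⟨m, rfl⟩ := Nat.exists_eq_succ_of_ne_zero hn
    rw [Function.iterate_succ_apply', hcyc m (by omega)]
    simp only [τ, if_neg (hblock (M + m) (by omega))]
    split_ifs <;> omega
  refine ⟨τ, funext fun k => ?_, fun k hk i => hτN i k hk, fun k hk i => ?_, hcyc⟩
  · by_cases h₁ : k ∈ N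
    · rw [hτN n k h₁, hσ]
    by_cases h₂ : M ≤ k ∧ k < M + n
    · obtain ⟨i, rfl⟩ := Nat.exists_eq_add_of_le h₂.1
      rw [← hcyc i (by omega), ← Function.iterate_add_apply, add_comm,
        Function.iterate_add_apply, hcycn]
      rfl
    · exact hfix k h₁ h₂ n
  · by_cases h₁ : k ∈ N
    · rw [hτN i k h₁]
      exact hM _ (hσN i k h₁)
    · rwa [hfix k h₁ (by omega) i]

theorem prod_range_add_of_periodic {α : Type*} [CommMonoid α] {n : ℕ} {g : ℕ → α}
    (hg : ∀ i, g (i + n) = g i) (e : ℕ) :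
    ∏ i ∈ Finset.range n, g (i + e) = ∏ i ∈ Finset.range n, g i := by
  induction e with
  | zero => rfl
  | succ e ih =>
    rw [← ih]
    have h₃ : g (n + e) = g (0 + e) := by rw [add_comm, hg, zero_add]
    cases n with
    | zero => simp
    | succ n =>
      rw [Finset.prod_range_succ, Finset.prod_range_succ' (fun i => g (i + e))]
      congr 1
      · exact Finset.prod_congr rfl fun i _ => by rw [show i + (e + 1) = i + 1 + e by omega]
      · rw [← h₃, show n + (e + 1) = n + 1 + e by omega]

theorem toClass_parList_orbitList (n : ℕ) (σ : Name → Name) (X : PiA) :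
    toClass (parList (orbitList n σ X)) =
      ∏ i ∈ Finset.range n, toClass (subst (σ^[i]) X) := by
  rw [toClass_parList, Finset.prod_range, orbitList, List.map_map, ← List.prod_ofFn]
  congr 1
  refine List.ext_getElem (by simp) fun i _ _ => by simp

/-- Outputs offered by all components of a network can be exchanged cyclically. -/
theorem cong_rotate_outputs {n : ℕ} {τ : Name → Name} (hτ : τ^[n] = id) (a z : Name) (A : PiA)
    (e : ℕ) :
    Cong (parList (orbitList n τ (par (out a z) A)))
      (parList (orbitList n τ (par A (out (τ^[e] a) (τ^[e] z))))) := by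
  rw [← toClass_eq, toClass_parList_orbitList, toClass_parList_orbitList]
  simp only [subst, toClass_par, Finset.prod_mul_distrib, ← Function.iterate_add_apply]
  rw [mul_comm]
  congr 1
  refine (prod_range_add_of_periodic (fun i => ?_) e).symm
  rw [Function.iterate_add, hτ, Function.comp_id]

theorem SymNetwork.exists_stepN {n : ℕ} (hn : n ≠ 0) {P : PiA} (h : SymNetwork n P)
    (hP : ∃ T, Step P T) : ∃ P', SymNetwork n P' ∧ StepN n P P' := by
  obtain ⟨xs, X, σ, hσ, rfl⟩ := symNetwork_iff.1 h
  have hinj := injective_of_iterate_eq_id hn hσ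
  obtain ⟨T, hT⟩ := hP
  rcases hasRedex_parList (hasRedex_resList.1 hT.hasRedex) with
    ⟨Y, hY, hr⟩ | ⟨Y, hY, Z, hZ, y, ho, hi⟩
  · obtain ⟨i, -, rfl⟩ := List.mem_map.1 hY
    obtain ⟨X', hX'⟩ := ((hasRedex_subst (hinj.iterate i).injOn).1 hr).exists_step
    exact exists_stepN_of_step hn hσ (.refl _) hX'
  obtain ⟨i, -, rfl⟩ := List.mem_map.1 hY
  obtain ⟨j, -, rfl⟩ := List.mem_map.1 hZ
  obtain ⟨a, rfl, ha⟩ := (outBarb_subst (hinj.iterate i).injOn).1 ho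
  obtain ⟨b, hab, hb⟩ := (inBarb_subst (hinj.iterate j).injOn).1 hi
  obtain ⟨e, he⟩ : ∃ e, σ^[e] a = b := by
    refine ⟨(n * j - j) + i, ?_⟩
    rw [Function.iterate_add_apply, ← hab, ← Function.iterate_add_apply,
      Nat.sub_add_cancel (Nat.le_mul_of_pos_left j (by omega)), iterate_mul_eq_id hσ]
    rfl
  obtain ⟨c, z, A, -, hca, hX⟩ := ha.exists_cong ∅
  let N : Finset Name := (Finset.range n).biUnion fun i => (names X).image (σ^[i])
  have hXN : ∀ k ∈ names X, k ∈ N := fun k hk => by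
    simp only [N, Finset.mem_biUnion, Finset.mem_range, Finset.mem_image]
    exact ⟨0, by omega, k, hk, rfl⟩
  have hN : ∀ k ∈ N, σ k ∈ N := by
    simp only [N, Finset.mem_biUnion, Finset.mem_range, Finset.mem_image]
    rintro _ ⟨i, hi, k, hk, rfl⟩
    rw [← Function.iterate_succ_apply' σ]
    by_cases hin : i + 1 = n
    · exact ⟨0, by omega, k, hk, by rw [Nat.succ_eq_add_one, hin, hσ]; rfl⟩
    · exact ⟨i + 1, by omega, k, hk, rfl⟩
  obtain ⟨M, hM⟩ : ∃ M, ∀ k ∈ N ∪ names (par (out a z) A), k < M :=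
    ⟨_, fun k hk => Nat.lt_succ_of_le (Finset.le_sup (f := id) hk)⟩
  obtain ⟨τ, hτ, hτσ, hτM, hτc⟩ :=
    exists_fresh_cycle hn hσ hN fun k hk => hM k (Finset.mem_union_left _ hk)
  have hτinj := injective_of_iterate_eq_id hn hτ
  have hMB : M ∉ names (par (out a z) A) := fun h =>
    (hM M (Finset.mem_union_right _ h)).false
  replace hX := hX.trans (.alpha_out hca hMB)
  have hB : ∀ k ∈ names (par (out a (rename c M z)) (subst (rename c M) A)), k < M ∨ k = M := by
    have hren : par (out a (rename c M z)) (subst (rename c M) A)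
        = subst (rename c M) (par (out a z) A) := by
      simp [subst, rename, hca.symm]
    rw [hren, names_subst]
    simp only [Finset.mem_image]
    rintro _ ⟨k, hk, rfl⟩
    have := hM k (Finset.mem_union_right _ hk)
    unfold rename
    split_ifs
    exacts [.inr rfl, .inl this]
  generalize rename c M z = z at hX hB
  generalize subst (rename c M) A = A at hX hB
  have hAb : InBarb A b := by
    rcases ((hX.inBarb_iff b).1 hb).2 with h | h
    exacts [h.elim, h]
  have hτa : τ^[e] a = b := by rw [hτσ a (hXN a ha.mem_names), he]
  obtain ⟨A', hA'⟩ := hAb.exists_step (τ^[e] z)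
  rw [← hτa] at hA'
  refine exists_stepN_of_step hn hτ (xs := xs ++ (List.range n).reverse.map fun i => τ^[i] M)
    ?_ hA'
  rw [resList_append]
  refine .resList _ (Cong.trans ?_ (.resList _ (cong_rotate_outputs hτ a z A e)))
  refine Cong.trans ?_ (cong_extrude_parList (fun i => τ^[i] M)
    (fun i => subst (τ^[i]) (par (out a z) A)) n fun i hi j hj hij hc => ?_)
  · rw [← toClass_eq, toClass_parList, toClass_parList, orbitList, List.map_map, List.map_map]
    congr 1
    refine List.map_congr_left fun i _ => toClass_eq.2 ?_
    beta_reduce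
    rw [subst_congr fun k hk => (hτσ k (hXN k hk) i).symm]
    exact hX.subst (hτinj.iterate i)
  · have hc := fn_subset_names _ hc
    rw [names_subst, Finset.mem_image] at hc
    obtain ⟨k, hk, hkM⟩ := hc
    rw [hτc i hi] at hkM
    rcases hB k hk with h | rfl
    · exact Nat.not_lt.2 (Nat.le_add_right M i) (hkM ▸ hτM k h j)
    · rw [hτc j hj] at hkM
      exact hij (Nat.add_left_cancel hkM).symm

/-! STATEMENT 0: Every symmetric network in the asynchronous π-calculus π_a
has at least one symmetric execution. -/
theorem every_symmetric_network_has_a_symmetric_execution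
    (n : ℕ) (P : PiA) (h : SymNetwork n P) :
    ∃ (seq : ℕ → PiA) (len : Option ℕ),
      seq 0 = P ∧ IsSymExecution n seq len := by
  rcases eq_or_ne n 0 with rfl | hn
  · refine ⟨fun _ => P, some 0, rfl, h, by simp, fun T hT => ?_, fun _ _ => h, h⟩
    obtain ⟨xs, X, σ, -, rfl⟩ := symNetwork_iff.1 h
    exact hasRedex_resList.1 hT.hasRedex
  have round : ∀ Q : PiA, ∃ g : ℕ → PiA, g 0 = Q ∧ (SymNetwork n Q → SymNetwork n (g n) ∧
      ((∃ T, Step Q T) → ∀ i < n, Step (g i) (g (i + 1)))) := by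
    intro Q
    by_cases hQ : SymNetwork n Q ∧ ∃ T, Step Q T
    · obtain ⟨Q', hQ', hs⟩ := hQ.1.exists_stepN hn hQ.2
      obtain ⟨g, h0, hgn, hg⟩ := hs.exists_seq
      exact ⟨g, h0, fun _ => ⟨hgn ▸ hQ', fun _ => hg⟩⟩
    · exact ⟨fun _ => Q, rfl, fun hs => ⟨hs, fun hT => absurd ⟨hs, hT⟩ hQ⟩⟩
  choose g hg0 hg using round
  let net : ℕ → PiA := fun k => (fun Q => g Q n)^[k] P
  have net_succ (k : ℕ) : net (k + 1) = g (net k) n := Function.iterate_succ_apply' _ k P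
  have hnet (k : ℕ) : SymNetwork n (net k) := by
    induction k with
    | zero => exact h
    | succ k ih => exact net_succ k ▸ (hg _ ih).1
  let seq : ℕ → PiA := fun i => g (net (i / n)) (i % n)
  have hpos : 0 < n := Nat.pos_of_ne_zero hn
  have hmul (k : ℕ) : seq (n * k) = net k := by
    simp [seq, Nat.mul_div_cancel_left k hpos, hg0]
  have hseq (i : ℕ) (hi : ∃ T, Step (net (i / n)) T) : Step (seq i) (seq (i + 1)) := by
    have hs := (hg _ (hnet (i / n))).2 hi (i % n) (Nat.mod_lt i hpos)
    suffices hnext : seq (i + 1) = g (net (i / n)) (i % n + 1) from hnext ▸ hs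
    have hlt := Nat.mod_lt i hpos
    have hdiv := Nat.div_add_mod i n
    by_cases hin : i % n + 1 = n
    · rw [show i + 1 = n * (i / n + 1) by rw [mul_add]; omega, hmul, net_succ, hin]
    · obtain ⟨h₁, h₂⟩ : (i + 1) / n = i / n ∧ (i + 1) % n = i % n + 1 :=
        (Nat.div_mod_unique hpos).2 ⟨by omega, by omega⟩
      simp only [seq, h₁, h₂]
  have hseq0 : seq 0 = P := hmul 0
  by_cases hinf : ∀ k, ∃ T, Step (net k) T
  · exact ⟨seq, none, hseq0, hseq0 ▸ h, fun i => hseq i (hinf _), fun k => hmul k ▸ hnet k⟩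
  · push Not at hinf
    classical
    let K := Nat.find hinf
    refine ⟨seq, some (n * K), hseq0, hseq0 ▸ h, fun i hi => hseq i ?_, ?_,
      fun k _ => hmul k ▸ hnet k, hmul K ▸ hnet K⟩
    · have := Nat.find_min hinf (Nat.div_lt_of_lt_mul hi)
      push Not at this
      exact this
    · exact hmul K ▸ Nat.find_spec hinf
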